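/- Assume that for every treatment vector a ∈ 𝒜 the families B and (G,B) satisfy positivity, and that A_k ⊥⊥ G_k | B_k for every k = 0,…,p. Then Var(ψ_Δ(B)) − Var(ψ_Δ((G,B))) ≥ 0. (Lemma 4.1 of the paper, causal-contrast version.) -/

import Mathlib

open MeasureTheory ProbabilityTheory

noncomputable section

/-- The σ-algebra generated by a set of real-valued random variables. -/
def genSig {Ω : Type*} (S : Set (Ω → ℝ)) : MeasurableSpace Ω :=
  ⨆ f ∈ S, MeasurableSpace.comap f (inferInstance : MeasurableSpace ℝ)

/-- Indicator `1_{A = a}` of the event that the random variable `A` takes the value `a`. -/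
def ind {Ω : Type*} (A : Ω → ℝ) (a : ℝ) : Ω → ℝ := fun ω => if A ω = a then 1 else 0

/-- `I_{ā_{k-1}}(Ā_{k-1}) = ∏_{j<k} 1_{A_j = a_j}` (equal to `1` when `k = 0`). -/
def indUpto {Ω : Type*} (A : ℕ → Ω → ℝ) (a : ℕ → ℝ) (k : ℕ) : Ω → ℝ :=
  fun ω => ∏ j ∈ Finset.range k, ind (A j) (a j) ω

variable {Ω : Type*} [MeasurableSpace Ω]

/-- Propensity `π_{a_k}(Z_k) = E[1_{A_k = a_k} ∣ σ(Z_k)]`. -/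
def propen (μ : Measure Ω) (A : ℕ → Ω → ℝ) (a : ℕ → ℝ) (Z : ℕ → Set (Ω → ℝ)) (k : ℕ) : Ω → ℝ :=
  μ[ind (A k) (a k) | genSig (Z k)]

/-- Cumulative weight `λ_{ā_{k-1}}(Z̄_{k-1}) = ∏_{j<k} π_{a_j}(Z_j)` (equal to `1` when `k = 0`). -/
def cumWeight (μ : Measure Ω) (A : ℕ → Ω → ℝ) (a : ℕ → ℝ) (Z : ℕ → Set (Ω → ℝ)) (k : ℕ) :
    Ω → ℝ :=
  fun ω => ∏ j ∈ Finset.range k, propen μ A a Z j ω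

/-- The adjustment family `Z` satisfies positivity: the propensities are uniformly bounded away
from `0` almost surely, for every time `k = 0, …, p`. -/
def Positivity (μ : Measure Ω) (A : ℕ → Ω → ℝ) (a : ℕ → ℝ) (Z : ℕ → Set (Ω → ℝ)) (p : ℕ) :
    Prop :=
  ∃ c : ℝ, 0 < c ∧ ∀ k ≤ p, ∀ᵐ ω ∂μ, c ≤ propen μ A a Z k ω

/-- Auxiliary downward recursion: `bAux μ A a Y Z p n` is the iterated regression
`b_{a_{p-n}}(Z)`. -/
def bAux (μ : Measure Ω) (A : ℕ → Ω → ℝ) (a : ℕ → ℝ) (Y : Ω → ℝ) (Z : ℕ → Set (Ω → ℝ))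
    (p : ℕ) : ℕ → Ω → ℝ
  | 0 => fun ω =>
      (μ[fun ω' => Y ω' * ind (A p) (a p) ω' | genSig (Z p)]) ω / propen μ A a Z p ω
  | n + 1 => fun ω =>
      (μ[fun ω' => bAux μ A a Y Z p n ω' * ind (A (p - (n + 1))) (a (p - (n + 1))) ω' |
          genSig (Z (p - (n + 1)))]) ω / propen μ A a Z (p - (n + 1)) ω

/-- Iterated regression `b_{a_k}(Z)`, for `k = 0, …, p`. -/
def breg (μ : Measure Ω) (A : ℕ → Ω → ℝ) (a : ℕ → ℝ) (Y : Ω → ℝ) (Z : ℕ → Set (Ω → ℝ))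
    (p k : ℕ) : Ω → ℝ :=
  bAux μ A a Y Z p (p - k)

/-- `b_{a_{k-1}}(Z)` with the convention `b_{a_{-1}}(Z) = E[b_{a_0}(Z)]` (a constant). -/
def bregPrev (μ : Measure Ω) (A : ℕ → Ω → ℝ) (a : ℕ → ℝ) (Y : Ω → ℝ) (Z : ℕ → Set (Ω → ℝ))
    (p k : ℕ) : Ω → ℝ :=
  if k = 0 then fun _ => ∫ ω, breg μ A a Y Z p 0 ω ∂μ else breg μ A a Y Z p (k - 1)

/-- The influence function `ψ_a(Z)`. -/
def psi (μ : Measure Ω) (A : ℕ → Ω → ℝ) (a : ℕ → ℝ) (Y : Ω → ℝ) (Z : ℕ → Set (Ω → ℝ))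
    (p : ℕ) : Ω → ℝ := fun ω =>
  indUpto A a (p + 1) ω * (Y ω - breg μ A a Y Z p p ω) / cumWeight μ A a Z (p + 1) ω +
    ∑ k ∈ Finset.range (p + 1),
      indUpto A a k ω * (breg μ A a Y Z p k ω - bregPrev μ A a Y Z p k ω) /
        cumWeight μ A a Z k ω

end

/-- `f` is `m`-strongly measurable and `P`-essentially bounded. -/
structure IsBddMeas {Ω : Type*} {mΩ : MeasurableSpace Ω} (P : Measure Ω) (m : MeasurableSpace Ω)
    (f : Ω → ℝ) : Prop where
  meas : StronglyMeasurable[m] f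
  bdd : ∃ C : ℝ, ∀ᵐ ω ∂P, |f ω| ≤ C

namespace IsBddMeas

variable {Ω : Type*} {m m' mΩ : MeasurableSpace Ω} {P : Measure Ω} {f g : Ω → ℝ}

theorem mono (hf : IsBddMeas P m f) (h : m ≤ m') : IsBddMeas P m' f :=
  ⟨hf.meas.mono h, hf.bdd⟩

theorem const (c : ℝ) : IsBddMeas P m (fun _ => c) :=
  ⟨stronglyMeasurable_const, |c|, ae_of_all _ fun _ => le_rfl⟩

theorem mul (hf : IsBddMeas P m f) (hg : IsBddMeas P m g) :
    IsBddMeas P m (fun ω => f ω * g ω) := by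
  obtain ⟨C, hC⟩ := hf.bdd
  obtain ⟨D, hD⟩ := hg.bdd
  refine ⟨hf.meas.mul hg.meas, C * D, ?_⟩
  filter_upwards [hC, hD] with ω h₁ h₂
  rw [abs_mul]
  exact mul_le_mul h₁ h₂ (abs_nonneg _) ((abs_nonneg _).trans h₁)

theorem add (hf : IsBddMeas P m f) (hg : IsBddMeas P m g) :
    IsBddMeas P m (fun ω => f ω + g ω) := by
  obtain ⟨C, hC⟩ := hf.bdd
  obtain ⟨D, hD⟩ := hg.bdd
  refine ⟨hf.meas.add hg.meas, C + D, ?_⟩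
  filter_upwards [hC, hD] with ω h₁ h₂
  exact (abs_add_le _ _).trans (add_le_add h₁ h₂)

theorem sub (hf : IsBddMeas P m f) (hg : IsBddMeas P m g) :
    IsBddMeas P m (fun ω => f ω - g ω) := by
  simpa [sub_eq_add_neg] using hf.add ((const (-1)).mul hg)

theorem sum {ι : Type*} {s : Finset ι} {f : ι → Ω → ℝ} (hf : ∀ i ∈ s, IsBddMeas P m (f i)) :
    IsBddMeas P m (fun ω => ∑ i ∈ s, f i ω) := by
  classical
  induction s using Finset.induction_on with
  | empty => simpa using const 0
  | insert i s his ih =>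
    simp only [Finset.sum_insert his]
    exact (hf i (by simp)).add (ih fun j hj => hf j (by simp [hj]))

theorem inv (hf : StronglyMeasurable[m] f) {c : ℝ} (hc : 0 < c) (hcf : ∀ᵐ ω ∂P, c ≤ f ω) :
    IsBddMeas P m (fun ω => (f ω)⁻¹) := by
  refine ⟨hf.measurable.inv.stronglyMeasurable, c⁻¹, ?_⟩
  filter_upwards [hcf] with ω h
  rw [abs_of_pos (inv_pos.2 (hc.trans_le h))]
  exact inv_anti₀ hc h

theorem condExp (hf : IsBddMeas P mΩ f) : IsBddMeas P m (P[f | m]) := by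
  obtain ⟨C, hC⟩ := hf.bdd
  refine ⟨stronglyMeasurable_condExp, C, ae_bdd_abs_condExp_of_ae_bdd_abs hC⟩

theorem memLp [IsFiniteMeasure P] (hf : IsBddMeas P mΩ f) (q : ENNReal) : MemLp f q P := by
  obtain ⟨C, hC⟩ := hf.bdd
  exact MemLp.of_bound hf.meas.aestronglyMeasurable C hC

theorem integrable [IsFiniteMeasure P] (hf : IsBddMeas P mΩ f) : Integrable f P :=
  memLp_one_iff_integrable.1 (hf.memLp 1)

theorem indicator_one {s : Set Ω} (hs : MeasurableSet[m] s) :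
    IsBddMeas P m (s.indicator fun _ => (1 : ℝ)) := by
  refine ⟨stronglyMeasurable_const.indicator hs, 1, ae_of_all _ fun ω => ?_⟩
  by_cases h : ω ∈ s <;> simp [h]

theorem condExp_mul [IsFiniteMeasure P] (hm : m ≤ mΩ) (hf : IsBddMeas P m f)
    (hg : IsBddMeas P mΩ g) :
    P[fun ω => f ω * g ω | m] =ᵐ[P] fun ω => f ω * (P[g | m]) ω :=
  condExp_mul_of_stronglyMeasurable_left hf.meas ((hf.mono hm).mul hg).integrable hg.integrable

theorem integral_mul_condExp [IsFiniteMeasure P] (hm : m ≤ mΩ) (hf : IsBddMeas P m f)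
    (hg : IsBddMeas P mΩ g) :
    ∫ ω, f ω * (P[g | m]) ω ∂P = ∫ ω, f ω * g ω ∂P := by
  rw [← integral_condExp hm (f := fun ω => f ω * g ω)]
  exact integral_congr_ae (hf.condExp_mul hm hg).symm

end IsBddMeas

/-- Conditioning additionally on a conditionally independent σ-algebra changes nothing. -/
theorem ProbabilityTheory.CondIndep.condExp_sup_ae_eq {Ω : Type*}
    {m' m₁ m₂ mΩ : MeasurableSpace Ω}
    [StandardBorelSpace Ω] {hm' : m' ≤ mΩ} {P : Measure Ω} [IsFiniteMeasure P]
    (hm₁ : m₁ ≤ mΩ) (hm₂ : m₂ ≤ mΩ) (h : CondIndep m' m₁ m₂ hm' P) {s : Set Ω}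
    (hs : MeasurableSet[m₁] s) :
    P[s.indicator fun _ => (1 : ℝ) | m₂ ⊔ m'] =ᵐ[P] P[s.indicator fun _ => (1 : ℝ) | m'] := by
  have hle : m₂ ⊔ m' ≤ mΩ := sup_le hm₂ hm'
  have hsb : IsBddMeas P mΩ (s.indicator fun _ => (1 : ℝ)) :=
    .indicator_one (hm₁ s hs)
  have hcs : IsBddMeas P m' (P[s.indicator fun _ => (1 : ℝ) | m']) := hsb.condExp
  have hcs' : StronglyMeasurable[m₂ ⊔ m'] (P[s.indicator fun _ => (1 : ℝ) | m']) :=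
    hcs.meas.mono le_sup_right
  have hci := (condIndep_iff m' m₁ m₂ hm' hm₁ hm₂ P).1 h
  refine (ae_eq_condExp_of_forall_setIntegral_eq hle hsb.integrable
    (fun _ _ _ => integrable_condExp.integrableOn) (fun t ht _ => ?_)
    hcs'.aestronglyMeasurable).symm
  set C : Set (Set Ω) :=
    Set.image2 (· ∩ ·) {t | MeasurableSet[m'] t} {u | MeasurableSet[m₂] u} with hC
  have hgen : m₂ ⊔ m' = MeasurableSpace.generateFrom C := by
    apply le_antisymm
    · refine sup_le (fun u hu => ?_) (fun t ht => ?_)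
      · exact MeasurableSpace.measurableSet_generateFrom
          ⟨Set.univ, MeasurableSet.univ, u, hu, by simp⟩
      · exact MeasurableSpace.measurableSet_generateFrom
          ⟨t, ht, Set.univ, MeasurableSet.univ, by simp⟩
    · refine MeasurableSpace.generateFrom_le ?_
      rintro _ ⟨t, ht, u, hu, rfl⟩
      exact MeasurableSet.inter (le_sup_right (a := m₂) t ht) (le_sup_left (b := m') u hu)
  have hpi : IsPiSystem C := by
    rintro _ ⟨t, ht, u, hu, rfl⟩ _ ⟨t', ht', u', hu', rfl⟩ _
    exact ⟨t ∩ t', MeasurableSet.inter ht ht', u ∩ u', MeasurableSet.inter hu hu',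
      Set.inter_inter_inter_comm _ _ _ _⟩
  have huniv : ∫ ω, (P[s.indicator fun _ => (1 : ℝ) | m']) ω ∂P
      = ∫ ω, s.indicator (fun _ => (1 : ℝ)) ω ∂P := integral_condExp hm'
  induction t, ht using MeasurableSpace.induction_on_inter hgen hpi with
  | empty => simp
  | basic t ht =>
    obtain ⟨t, ht, u, hu, rfl⟩ := ht
    have ht' : MeasurableSet[m'] t := ht
    have hub : IsBddMeas P mΩ (u.indicator fun _ => (1 : ℝ)) := .indicator_one (hm₂ u hu)
    have htb : IsBddMeas P m' (t.indicator fun _ => (1 : ℝ)) := .indicator_one ht'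
    have hsu : IsBddMeas P mΩ ((s ∩ u).indicator fun _ => (1 : ℝ)) :=
      .indicator_one ((hm₁ s hs).inter (hm₂ u hu))
    have htu : MeasurableSet[mΩ] (t ∩ u) := (hm' t ht').inter (hm₂ u hu)
    calc ∫ ω in t ∩ u, (P[s.indicator fun _ => (1 : ℝ) | m']) ω ∂P
        = ∫ ω, (t.indicator (fun _ => (1 : ℝ)) ω * (P[s.indicator fun _ => (1 : ℝ) | m']) ω) *
            u.indicator (fun _ => (1 : ℝ)) ω ∂P := by
          rw [← integral_indicator htu]
          refine integral_congr_ae (ae_of_all _ fun ω => ?_)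
          by_cases h₁ : ω ∈ t <;> by_cases h₂ : ω ∈ u <;> simp [h₁, h₂]
      _ = ∫ ω, (t.indicator (fun _ => (1 : ℝ)) ω * (P[s.indicator fun _ => (1 : ℝ) | m']) ω) *
            (P[u.indicator fun _ => (1 : ℝ) | m']) ω ∂P :=
          ((htb.mul hcs).integral_mul_condExp hm' hub).symm
      _ = ∫ ω, t.indicator (fun _ => (1 : ℝ)) ω *
            (P[(s ∩ u).indicator fun _ => (1 : ℝ) | m']) ω ∂P := by
          refine integral_congr_ae ?_
          filter_upwards [hci s u hs hu] with ω hω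
          rw [hω, Pi.mul_apply, mul_assoc]
      _ = ∫ ω, t.indicator (fun _ => (1 : ℝ)) ω * (s ∩ u).indicator (fun _ => (1 : ℝ)) ω ∂P :=
          htb.integral_mul_condExp hm' hsu
      _ = ∫ ω in t ∩ u, s.indicator (fun _ => (1 : ℝ)) ω ∂P := by
          rw [← integral_indicator htu]
          refine integral_congr_ae (ae_of_all _ fun ω => ?_)
          by_cases h₁ : ω ∈ t <;> by_cases h₂ : ω ∈ u <;> by_cases h₃ : ω ∈ s <;>
            simp [h₁, h₂, h₃]
  | compl t htm ih =>
    rw [setIntegral_compl (hle t htm) integrable_condExp,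
      setIntegral_compl (hle t htm) hsb.integrable, ih (measure_lt_top _ _), huniv]
  | iUnion f hd hfm ih =>
    rw [integral_iUnion (fun i => hle _ (hfm i)) hd integrable_condExp.integrableOn,
      integral_iUnion (fun i => hle _ (hfm i)) hd hsb.integrable.integrableOn]
    exact tsum_congr fun i => ih i (measure_lt_top _ _)

section Orthogonality

variable {Ω : Type*} {m mΩ : MeasurableSpace Ω} {P : Measure Ω} [IsFiniteMeasure P]

theorem integral_sum_mul_eq_zero {ι : Type*} {s : Finset ι} {f : ι → Ω → ℝ} {g : Ω → ℝ}
    (hf : ∀ i ∈ s, IsBddMeas P mΩ (f i)) (hg : IsBddMeas P mΩ g)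
    (h : ∀ i ∈ s, ∫ ω, f i ω * g ω ∂P = 0) : ∫ ω, (∑ i ∈ s, f i ω) * g ω ∂P = 0 := by
  simp_rw [Finset.sum_mul]
  rw [integral_finsetSum _ fun i hi => ((hf i hi).mul hg).integrable]
  exact Finset.sum_eq_zero h

theorem integral_mul_sum_eq_zero {ι : Type*} {s : Finset ι} {f : Ω → ℝ} {g : ι → Ω → ℝ}
    (hf : IsBddMeas P mΩ f) (hg : ∀ i ∈ s, IsBddMeas P mΩ (g i))
    (h : ∀ i ∈ s, ∫ ω, f ω * g i ω ∂P = 0) : ∫ ω, f ω * (∑ i ∈ s, g i ω) ∂P = 0 := by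
  simp_rw [mul_comm (f _)] at h ⊢
  exact integral_sum_mul_eq_zero hg hf h

/-- Inverse-propensity residuals are orthogonal to the conditioning σ-algebra. -/
theorem integral_mul_one_sub_mul_eq_zero (hm : m ≤ mΩ) {f I q : Ω → ℝ} (hf : IsBddMeas P m f)
    (hI : IsBddMeas P mΩ I) (hq : IsBddMeas P m q)
    (hqI : ∀ᵐ ω ∂P, (P[I | m]) ω * q ω = 1) :
    ∫ ω, f ω * (1 - I ω * q ω) ∂P = 0 := by
  have hfq := hf.mul hq
  have e : ∫ ω, f ω * (1 - I ω * q ω) ∂P = ∫ ω, (f ω - (f ω * q ω) * I ω) ∂P := by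
    congr 1; ext ω; ring
  rw [e, integral_sub (hf.mono hm).integrable ((hfq.mono hm).mul hI).integrable,
    ← hfq.integral_mul_condExp hm hI, sub_eq_zero]
  refine integral_congr_ae ?_
  filter_upwards [hqI] with ω h
  rw [mul_assoc, mul_comm (q ω), h, mul_one]

/-- Regression residuals within a treatment arm are orthogonal to the conditioning σ-algebra. -/
theorem integral_mul_mul_sub_eq_zero (hm : m ≤ mΩ) {f I n b : Ω → ℝ} (hf : IsBddMeas P m f)
    (hI : IsBddMeas P mΩ I) (hn : IsBddMeas P mΩ n) (hb : IsBddMeas P m b)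
    (h : ∀ᵐ ω ∂P, (P[fun ω => n ω * I ω | m]) ω = b ω * (P[I | m]) ω) :
    ∫ ω, f ω * (I ω * (n ω - b ω)) ∂P = 0 := by
  have hfb := hf.mul hb
  have hnI := hn.mul hI
  have e : ∫ ω, f ω * (I ω * (n ω - b ω)) ∂P
      = ∫ ω, (f ω * (n ω * I ω) - (f ω * b ω) * I ω) ∂P := by
    congr 1; ext ω; ring
  rw [e, integral_sub ((hf.mono hm).mul hnI).integrable ((hfb.mono hm).mul hI).integrable,
    ← hfb.integral_mul_condExp hm hI, ← hf.integral_mul_condExp hm hnI, sub_eq_zero]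
  refine integral_congr_ae ?_
  filter_upwards [h] with ω h
  rw [h, mul_assoc]

theorem variance_le_variance_of_orthogonal [IsProbabilityMeasure P] {U V X D : Ω → ℝ} (r : ℝ)
    (hX : IsBddMeas P mΩ X) (hD : IsBddMeas P mΩ D) (hD0 : ∫ ω, D ω ∂P = 0)
    (hXD : ∫ ω, X ω * D ω ∂P = 0) (hV : V =ᵐ[P] X)
    (hU : U =ᵐ[P] fun ω => X ω + D ω + r) : variance V P ≤ variance U P := by
  have hXD' : IsBddMeas P mΩ (X + D) := hX.add hD
  have e : variance U P = variance (X + D) P := by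
    rw [variance_congr hU]
    exact variance_add_const hXD'.meas.aestronglyMeasurable r
  have hcov : covariance X D P = 0 := by
    rw [covariance_eq_sub (hX.memLp 2) (hD.memLp 2), hD0, mul_zero, sub_zero]
    exact hXD
  rw [e, variance_congr hV, variance_add (hX.memLp 2) (hD.memLp 2), hcov]
  linarith [variance_nonneg D P]

end Orthogonality

theorem genSig_mono {Ω : Type*} {S T : Set (Ω → ℝ)} (h : S ⊆ T) : genSig S ≤ genSig T :=
  biSup_mono h

theorem genSig_union {Ω : Type*} (S T : Set (Ω → ℝ)) :
    genSig (S ∪ T) = genSig S ⊔ genSig T :=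
  iSup_union

theorem measurable_genSig {Ω : Type*} {S : Set (Ω → ℝ)} {f : Ω → ℝ} (hf : f ∈ S) :
    Measurable[genSig S] f :=
  measurable_iff_comap_le.2
    (le_iSup₂ (f := fun g (_ : g ∈ S) => MeasurableSpace.comap g inferInstance) f hf)

theorem ind_eq_indicator {Ω : Type*} (A : Ω → ℝ) (a : ℝ) :
    ind A a = (A ⁻¹' {a}).indicator fun _ => (1 : ℝ) := by
  ext ω
  by_cases h : A ω = a <;> simp [ind, h]

theorem ind_mul_ind {Ω : Type*} (A : Ω → ℝ) (a b : ℝ) (ω : Ω) :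
    ind A a ω * ind A b ω = ind A a ω * if a = b then 1 else 0 := by
  by_cases h : A ω = a
  · simp [ind, h]
  · simp [ind, h]

/-- The inverse-probability weight `I_{ā_{k-1}}(Ā_{k-1}) / λ_{ā_{k-1}}(Z̄_{k-1})`. -/
noncomputable def ipWeight {Ω : Type*} [MeasurableSpace Ω] (P : Measure Ω) (A : ℕ → Ω → ℝ)
    (a : ℕ → ℝ) (Z : ℕ → Set (Ω → ℝ)) (k : ℕ) : Ω → ℝ :=
  fun ω => indUpto A a k ω / cumWeight P A a Z k ω

/-- The iterated regression at times `k ≤ p`, continued by the outcome itself afterwards. -/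
noncomputable def bregExt {Ω : Type*} [MeasurableSpace Ω] (P : Measure Ω) (A : ℕ → Ω → ℝ)
    (a : ℕ → ℝ) (Y : Ω → ℝ) (Z : ℕ → Set (Ω → ℝ)) (p k : ℕ) : Ω → ℝ :=
  if k ≤ p then breg P A a Y Z p k else Y

section InfluenceFunction

variable {Ω : Type*} {m mΩ : MeasurableSpace Ω} {P : Measure Ω} {A : ℕ → Ω → ℝ}
  {a : ℕ → ℝ} {Y : Ω → ℝ} {Z : ℕ → Set (Ω → ℝ)} {p k : ℕ}

theorem isBddMeas_ind {A : Ω → ℝ} (hA : Measurable[m] A) (a : ℝ) :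
    IsBddMeas P m (ind A a) := by
  rw [ind_eq_indicator]
  exact .indicator_one (hA (measurableSet_singleton a))

theorem bregExt_of_le (hk : k ≤ p) :
    bregExt P A a Y Z p k = fun ω =>
      (P[fun ω => bregExt P A a Y Z p (k + 1) ω * ind (A k) (a k) ω | genSig (Z k)]) ω /
        propen P A a Z k ω := by
  obtain rfl | hlt := hk.eq_or_lt
  · simp [bregExt, breg, bAux]
  · obtain ⟨n, rfl⟩ := Nat.exists_eq_add_of_lt hlt
    have h₁ : k + n + 1 - k = n + 1 := by lia
    have h₂ : k + n + 1 - (k + 1) = n := by lia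
    have h₃ : k + n + 1 - (n + 1) = k := by lia
    have h₄ : k + 1 ≤ k + n + 1 := by lia
    simp [bregExt, breg, hk, h₁, h₂, h₃, h₄, bAux]

theorem ipWeight_zero : ipWeight P A a Z 0 = fun _ => 1 := by
  ext ω
  simp [ipWeight, indUpto, cumWeight]

theorem ipWeight_succ (ω : Ω) :
    ipWeight P A a Z (k + 1) ω =
      ipWeight P A a Z k ω * (ind (A k) (a k) ω * (propen P A a Z k ω)⁻¹) := by
  simp only [ipWeight, indUpto, cumWeight, Finset.prod_range_succ]
  rw [mul_div_mul_comm, div_eq_mul_inv (ind _ _ _)]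

theorem psi_eq (ω : Ω) :
    psi P A a Y Z p ω =
      ∑ k ∈ Finset.range (p + 1), ipWeight P A a Z (k + 1) ω *
        (bregExt P A a Y Z p (k + 1) ω - bregExt P A a Y Z p k ω) +
      (bregExt P A a Y Z p 0 ω - ∫ ω, bregExt P A a Y Z p 0 ω ∂P) := by
  have h0 : bregExt P A a Y Z p 0 = breg P A a Y Z p 0 := by simp [bregExt]
  have hsum : ∑ k ∈ Finset.range p, ipWeight P A a Z (k + 1) ω *
        (bregExt P A a Y Z p (k + 1) ω - bregExt P A a Y Z p k ω) =
      ∑ k ∈ Finset.range p, indUpto A a (k + 1) ω *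
        (breg P A a Y Z p (k + 1) ω - bregPrev P A a Y Z p (k + 1) ω) /
          cumWeight P A a Z (k + 1) ω := by
    refine Finset.sum_congr rfl fun k hk => ?_
    have hk : k < p := Finset.mem_range.1 hk
    simp only [bregExt, Nat.succ_le_of_lt hk, hk.le, ipWeight, bregPrev]
    simp
    ring
  rw [psi, Finset.sum_range_succ', Finset.sum_range_succ, hsum, h0]
  simp [bregExt, bregPrev, ipWeight, indUpto, cumWeight]
  ring

theorem Positivity.isBddMeas_inv (h : Positivity P A a Z p) (hk : k ≤ p) :
    IsBddMeas P (genSig (Z k)) fun ω => (propen P A a Z k ω)⁻¹ := by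
  obtain ⟨c, hc, h⟩ := h
  exact .inv stronglyMeasurable_condExp hc (h k hk)

theorem Positivity.ae_ne_zero (h : Positivity P A a Z p) (hk : k ≤ p) :
    ∀ᵐ ω ∂P, propen P A a Z k ω ≠ 0 := by
  obtain ⟨c, hc, h⟩ := h
  filter_upwards [h k hk] with ω h
  exact (hc.trans_le h).ne'

theorem Positivity.isBddMeas_bregExt (h : Positivity P A a Z p) (hA : ∀ k, Measurable (A k))
    (hZ : ∀ k ≤ p, genSig (Z k) ≤ mΩ) (hY : IsBddMeas P mΩ Y) (hk : k ≤ p) :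
    IsBddMeas P (genSig (Z k)) (bregExt P A a Y Z p k) := by
  obtain ⟨n, hn⟩ := Nat.exists_eq_add_of_le hk
  have step : IsBddMeas P mΩ (bregExt P A a Y Z p (k + 1)) →
      IsBddMeas P (genSig (Z k)) (bregExt P A a Y Z p k) := fun h' => by
    rw [bregExt_of_le hk]
    exact (h'.mul (isBddMeas_ind (hA k) _)).condExp.mul (h.isBddMeas_inv hk)
  induction n generalizing k with
  | zero => exact step (by simpa [bregExt, hn] using hY)
  | succ n ih =>
    have hk' : k + 1 ≤ p := by lia
    refine step ((ih hk' (by lia) fun h' => ?_).mono (hZ _ hk'))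
    rw [bregExt_of_le hk']
    exact (h'.mul (isBddMeas_ind (hA _) _)).condExp.mul (h.isBddMeas_inv hk')

theorem Positivity.isBddMeas_ipWeight (h : Positivity P A a Z p)
    (hA : ∀ j < k, Measurable[m] (A j)) (hZ : ∀ j < k, genSig (Z j) ≤ m) (hk : k ≤ p + 1) :
    IsBddMeas P m (ipWeight P A a Z k) := by
  induction k with
  | zero => rw [ipWeight_zero]; exact .const 1
  | succ k ih =>
    rw [funext ipWeight_succ]
    exact (ih (fun j hj => hA j (by lia)) (fun j hj => hZ j (by lia)) (by lia)).mul
      ((isBddMeas_ind (hA k (by lia)) _).mul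
        ((h.isBddMeas_inv (by lia)).mono (hZ k (by lia))))

end InfluenceFunction

/-- `F` is a filtration up to time `p` recording past treatments and the adjustment sets `B`,
such that `A_k` depends on `F k` only through `B k`. -/
structure IsTreatmentHistory {Ω : Type*} {mΩ : MeasurableSpace Ω} (P : Measure Ω)
    (A : ℕ → Ω → ℝ) (B : ℕ → Set (Ω → ℝ)) (F : ℕ → MeasurableSpace Ω) (p : ℕ) : Prop where
  le : ∀ k ≤ p, F k ≤ mΩ
  mono : ∀ j k, j ≤ k → k ≤ p → F j ≤ F k
  measurable : ∀ j k, j < k → k ≤ p → Measurable[F k] (A j)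
  genSig_le : ∀ k ≤ p, genSig (B k) ≤ F k
  condExp_ind : ∀ k ≤ p, ∀ a : ℝ, P[ind (A k) a | F k] =ᵐ[P] P[ind (A k) a | genSig (B k)]

namespace IsTreatmentHistory

variable {Ω : Type*} {mΩ : MeasurableSpace Ω} {P : Measure Ω}
  {A : ℕ → Ω → ℝ} {B : ℕ → Set (Ω → ℝ)} {F : ℕ → MeasurableSpace Ω} {p : ℕ} {v w : ℕ → ℝ}

theorem isBddMeas_ipWeight (h : IsTreatmentHistory P A B F p) (hv : Positivity P A v B p) {k : ℕ}
    (hk : k ≤ p) : IsBddMeas P (F k) (ipWeight P A v B k) :=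
  hv.isBddMeas_ipWeight (fun j hj => h.measurable j k hj hk)
    (fun j hj => (h.genSig_le j (by lia)).trans (h.mono j k hj.le hk)) (by lia)

theorem isBddMeas_ipWeight_top (h : IsTreatmentHistory P A B F p) (hA : ∀ k, Measurable (A k))
    (hv : Positivity P A v B p) {k : ℕ} (hk : k ≤ p + 1) :
    IsBddMeas P mΩ (ipWeight P A v B k) :=
  hv.isBddMeas_ipWeight (fun j _ => hA j)
    (fun j hj => (h.genSig_le j (by lia)).trans (h.le j (by lia))) hk

theorem isBddMeas_inv (h : IsTreatmentHistory P A B F p) (hv : Positivity P A v B p) {k : ℕ}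
    (hk : k ≤ p) : IsBddMeas P (F k) fun ω => (propen P A v B k ω)⁻¹ :=
  (hv.isBddMeas_inv hk).mono (h.genSig_le k hk)

/-- The weight increment `W_k - W_{k+1}` integrates to zero against functions of the history. -/
theorem integral_mul_ipWeight_sub [IsFiniteMeasure P]
    (h : IsTreatmentHistory P A B F p)
    (hA : ∀ k, Measurable (A k)) (hv : Positivity P A v B p) {k : ℕ} (hk : k ≤ p) {f : Ω → ℝ}
    (hf : IsBddMeas P (F k) f) :
    ∫ ω, f ω * (ipWeight P A v B k ω - ipWeight P A v B (k + 1) ω) ∂P = 0 := by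
  rw [← integral_mul_one_sub_mul_eq_zero (h.le k hk) (hf.mul (h.isBddMeas_ipWeight hv hk))
    (isBddMeas_ind (hA k) (v k)) (h.isBddMeas_inv hv hk)]
  · simp_rw [ipWeight_succ]
    congr 1; ext ω; ring
  · filter_upwards [h.condExp_ind k hk (v k), hv.ae_ne_zero hk] with ω h₁ h₂
    rw [h₁]
    exact mul_inv_cancel₀ h₂

/-- The weighted regression residual integrates to zero against functions of the history. -/
theorem integral_mul_ipWeight_succ_mul_sub [IsFiniteMeasure P]
    (h : IsTreatmentHistory P A B F p)
    (hA : ∀ k, Measurable (A k)) (hv : Positivity P A v B p) {k : ℕ} (hk : k ≤ p) {n b : Ω → ℝ}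
    (hn : IsBddMeas P mΩ n) (hb : IsBddMeas P (F k) b)
    (hnb : ∀ᵐ ω ∂P, (P[fun ω => n ω * ind (A k) (v k) ω | F k]) ω =
      b ω * (P[ind (A k) (v k) | F k]) ω)
    {f : Ω → ℝ} (hf : IsBddMeas P (F k) f) :
    ∫ ω, f ω * (ipWeight P A v B (k + 1) ω * (n ω - b ω)) ∂P = 0 := by
  rw [← integral_mul_mul_sub_eq_zero (h.le k hk)
    (hf.mul ((h.isBddMeas_ipWeight hv hk).mul (h.isBddMeas_inv hv hk)))
    (isBddMeas_ind (hA k) (v k)) hn hb hnb]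
  simp_rw [ipWeight_succ]
  congr 1; ext ω; ring

/-- Regression residuals are orthogonal to adjustment residuals, at any times and for any
two treatment vectors. -/
theorem integral_ipWeight_succ_mul_sub_mul [IsFiniteMeasure P]
    (h : IsTreatmentHistory P A B F p)
    (hA : ∀ k, Measurable (A k)) (hv : Positivity P A v B p) (hw : Positivity P A w B p)
    {R : ℕ → Ω → ℝ} {d : Ω → ℝ} {j k : ℕ} (hk : k ≤ p) (hj : j ≤ p)
    (hR : ∀ k ≤ p, IsBddMeas P (F k) (R k)) (hRp : IsBddMeas P mΩ (R (k + 1)))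
    (hreg : ∀ᵐ ω ∂P, (P[fun ω => R (k + 1) ω * ind (A k) (v k) ω | F k]) ω =
      R k ω * (P[ind (A k) (v k) | F k]) ω)
    (hd : IsBddMeas P (F j) d) :
    ∫ ω, (ipWeight P A v B (k + 1) ω * (R (k + 1) ω - R k ω)) *
      (d ω * (ipWeight P A w B j ω - ipWeight P A w B (j + 1) ω)) ∂P = 0 := by
  rcases lt_trichotomy k j with hkj | rfl | hjk
  · have hf : IsBddMeas P (F j)
        fun ω => (ipWeight P A v B (k + 1) ω * (R (k + 1) ω - R k ω)) * d ω :=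
      (((h.isBddMeas_ipWeight hv (by lia)).mono (h.mono _ _ hkj hj)).mul
        (((hR (k + 1) (by lia)).mono (h.mono _ _ hkj hj)).sub
          ((hR k hk).mono (h.mono _ _ hkj.le hj)))).mul hd
    rw [← h.integral_mul_ipWeight_sub hA hw hj hf]
    simp_rw [mul_assoc]
  · have hf : IsBddMeas P (F k) fun ω => (d ω * ipWeight P A w B k ω) *
        (1 - (if v k = w k then 1 else 0) * (propen P A w B k ω)⁻¹) :=
      (hd.mul (h.isBddMeas_ipWeight hw hk)).mul
        ((IsBddMeas.const 1).sub ((IsBddMeas.const _).mul (h.isBddMeas_inv hw hk)))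
    rw [← h.integral_mul_ipWeight_succ_mul_sub hA hv hk hRp (hR k hk) hreg hf]
    congr 1; ext ω
    simp_rw [ipWeight_succ]
    linear_combination (-(ipWeight P A v B k ω * (propen P A v B k ω)⁻¹ * (R (k + 1) ω - R k ω) *
      d ω * ipWeight P A w B k ω * (propen P A w B k ω)⁻¹)) * ind_mul_ind (A k) (v k) (w k) ω
  · have hf : IsBddMeas P (F k)
        fun ω => d ω * (ipWeight P A w B j ω - ipWeight P A w B (j + 1) ω) :=
      (hd.mono (h.mono _ _ hjk.le hk)).mul
        (((h.isBddMeas_ipWeight hw hj).mono (h.mono _ _ hjk.le hk)).sub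
          ((h.isBddMeas_ipWeight hw (by lia)).mono (h.mono _ _ hjk hk)))
    rw [← h.integral_mul_ipWeight_succ_mul_sub hA hv hk hRp (hR k hk) hreg hf]
    congr 1; ext ω; ring

end IsTreatmentHistory

/-- Summation by parts. -/
theorem sum_range_mul_sub_add (W x : ℕ → ℝ) (n : ℕ) :
    ∑ k ∈ Finset.range n, W (k + 1) * (x (k + 1) - x k) + W 0 * x 0 =
      ∑ k ∈ Finset.range n, x k * (W k - W (k + 1)) + W n * x n := by
  induction n with
  | zero => simp
  | succ n ih =>
    rw [Finset.sum_range_succ, Finset.sum_range_succ]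
    linear_combination ih

theorem ipWeight_ae_eq {Ω : Type*} {mΩ : MeasurableSpace Ω} {P : Measure Ω} {A : ℕ → Ω → ℝ}
    {a : ℕ → ℝ} {Z Z' : ℕ → Set (Ω → ℝ)} {k : ℕ}
    (h : ∀ j < k, propen P A a Z j =ᵐ[P] propen P A a Z' j) :
    ipWeight P A a Z k =ᵐ[P] ipWeight P A a Z' k := by
  have h' : ∀ᵐ ω ∂P, ∀ j ∈ Finset.range k, propen P A a Z j ω = propen P A a Z' j ω :=
    (Finset.range k).eventually_all.2 fun j hj => h j (Finset.mem_range.1 hj)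
  filter_upwards [h'] with ω hω
  rw [ipWeight, ipWeight, cumWeight, cumWeight, Finset.prod_congr rfl hω]

theorem isTreatmentHistory_of_condIndep {Ω : Type*} {mΩ : MeasurableSpace Ω}
    [StandardBorelSpace Ω] {P : Measure Ω} [IsFiniteMeasure P] {p : ℕ} {A : ℕ → Ω → ℝ}
    (hA : ∀ k, Measurable (A k)) {K G B : ℕ → Set (Ω → ℝ)}
    (hGle : ∀ k, genSig (G k) ≤ mΩ) (hBle : ∀ k, genSig (B k) ≤ mΩ)
    (hcover : ∀ k ≤ p, G k ∪ B k = A '' Set.Iio k ∪ ⋃ j ∈ Set.Iic k, K j)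
    (hCI : ∀ k ≤ p, CondIndep (genSig (B k)) (MeasurableSpace.comap (A k) inferInstance)
      (genSig (G k)) (hBle k) P) :
    IsTreatmentHistory P A B (fun k => genSig (G k ∪ B k)) p where
  le k _ := (genSig_union _ _).trans_le (sup_le (hGle k) (hBle k))
  mono j k hjk hk := by
    refine genSig_mono ?_
    rw [hcover k hk, hcover j (hjk.trans hk)]
    exact Set.union_subset_union (Set.image_mono (Set.Iio_subset_Iio hjk))
      (Set.biUnion_subset_biUnion_left (Set.Iic_subset_Iic.2 hjk))
  measurable j k hjk hk := by
    refine measurable_genSig ?_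
    rw [hcover k hk]
    exact Or.inl ⟨j, hjk, rfl⟩
  genSig_le k _ := genSig_mono Set.subset_union_right
  condExp_ind k hk a := by
    rw [genSig_union, ind_eq_indicator]
    exact (hCI k hk).condExp_sup_ae_eq (hA k).comap_le (hGle k)
      ⟨{a}, measurableSet_singleton a, rfl⟩

/-- Lemma 4.1, causal-contrast version.  If for every treatment vector
`a ∈ 𝒜` the families `B` and `(G, B)` satisfy positivity and `A_k ⊥⊥ G_k ∣ B_k` for every
`k = 0, …, p`, then `Var(ψ_Δ(B)) - Var(ψ_Δ((G, B))) ≥ 0`. -/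
theorem variance_contrast_le_of_condIndep_add {Ω : Type*} [mΩ : MeasurableSpace Ω] [StandardBorelSpace Ω]
    (P : Measure Ω) [IsProbabilityMeasure P] (p : ℕ)
    (A : ℕ → Ω → ℝ) (hA : ∀ k, Measurable (A k))
    (hAfin : ∀ k, (Set.range (A k)).Finite)
    (Y : Ω → ℝ) (hYm : Measurable Y) (hYbd : ∃ C : ℝ, ∀ ω, |Y ω| ≤ C)
    (K G B : ℕ → Set (Ω → ℝ)) (hKfin : ∀ k, (K k).Finite)
    (hGle : ∀ k, genSig (G k) ≤ mΩ) (hBle : ∀ k, genSig (B k) ≤ mΩ)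
    (hdisj : ∀ k ≤ p, Disjoint (G k) (B k))
    (hcover : ∀ k ≤ p, G k ∪ B k = A '' Set.Iio k ∪ ⋃ j ∈ Set.Iic k, K j)
    (𝒜 : Finset (ℕ → ℝ))
    (h𝒜 : ∀ v : ℕ → ℝ, v ∈ 𝒜 ↔ ((∀ k ≤ p, v k ∈ Set.range (A k)) ∧ ∀ k, p < k → v k = 0))
    (c : (ℕ → ℝ) → ℝ)
    (hBpos : ∀ v ∈ 𝒜, Positivity P A v B p)
    (hGBpos : ∀ v ∈ 𝒜, Positivity P A v (fun k => G k ∪ B k) p)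
    (hCI : ∀ k ≤ p,
      CondIndep (genSig (B k)) (MeasurableSpace.comap (A k) inferInstance) (genSig (G k))
        (hBle k) P) :
    0 ≤ variance (fun ω => ∑ v ∈ 𝒜, c v * psi P A v Y B p ω) P -
        variance (fun ω => ∑ v ∈ 𝒜, c v * psi P A v Y (fun k => G k ∪ B k) p ω) P := by
  set Z : ℕ → Set (Ω → ℝ) := fun k => G k ∪ B k
  have hist := isTreatmentHistory_of_condIndep hA hGle hBle hcover hCI
  have hZle : ∀ k ≤ p, genSig (Z k) ≤ mΩ := hist.le
  obtain ⟨C, hC⟩ := hYbd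
  have hY : IsBddMeas P mΩ Y := ⟨hYm.stronglyMeasurable, C, ae_of_all _ hC⟩
  have hRZ : ∀ v ∈ 𝒜, ∀ k ≤ p, IsBddMeas P (genSig (Z k)) (bregExt P A v Y Z p k) :=
    fun v hv k hk => (hGBpos v hv).isBddMeas_bregExt hA hZle hY hk
  have hRB : ∀ v ∈ 𝒜, ∀ k ≤ p, IsBddMeas P (genSig (Z k)) (bregExt P A v Y B p k) :=
    fun v hv k hk => ((hBpos v hv).isBddMeas_bregExt hA (fun k _ => hBle k) hY hk).mono
      (hist.genSig_le k hk)
  have hRtop : ∀ v ∈ 𝒜, ∀ k ≤ p + 1, IsBddMeas P mΩ (bregExt P A v Y Z p k) := by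
    intro v hv k hk
    rcases Nat.lt_or_ge p k with h | h
    · simpa [bregExt, Nat.not_le.2 h] using hY
    · exact (hRZ v hv k h).mono (hZle k h)
  have hW : ∀ v ∈ 𝒜, ∀ k ≤ p + 1, IsBddMeas P mΩ (ipWeight P A v B k) :=
    fun v hv k hk => hist.isBddMeas_ipWeight_top hA (hBpos v hv) hk
  have hreg : ∀ v ∈ 𝒜, ∀ k ≤ p,
      ∀ᵐ ω ∂P, (P[fun ω => bregExt P A v Y Z p (k + 1) ω * ind (A k) (v k) ω | genSig (Z k)]) ω =
        bregExt P A v Y Z p k ω * (P[ind (A k) (v k) | genSig (Z k)]) ω := by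
    intro v hv k hk
    filter_upwards [(hGBpos v hv).ae_ne_zero hk] with ω hω
    rw [bregExt_of_le hk]
    exact (div_mul_cancel₀ _ hω).symm
  let S : (ℕ → ℝ) → ℕ → Ω → ℝ := fun v k ω => ipWeight P A v B (k + 1) ω *
    (bregExt P A v Y Z p (k + 1) ω - bregExt P A v Y Z p k ω)
  let S₀ : (ℕ → ℝ) → Ω → ℝ := fun v ω =>
    bregExt P A v Y Z p 0 ω - ∫ ω, bregExt P A v Y Z p 0 ω ∂P
  let d : (ℕ → ℝ) → ℕ → Ω → ℝ := fun v j ω => bregExt P A v Y B p j ω - bregExt P A v Y Z p j ω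
  let T : (ℕ → ℝ) → ℕ → Ω → ℝ := fun v j ω =>
    d v j ω * (ipWeight P A v B j ω - ipWeight P A v B (j + 1) ω)
  let X : (ℕ → ℝ) → Ω → ℝ := fun v ω => ∑ k ∈ Finset.range (p + 1), S v k ω + S₀ v ω
  have hS : ∀ v ∈ 𝒜, ∀ k ∈ Finset.range (p + 1), IsBddMeas P mΩ (S v k) := fun v hv k hk =>
    have hk := Finset.mem_range.1 hk
    (hW v hv _ (by lia)).mul ((hRtop v hv _ (by lia)).sub (hRtop v hv _ (by lia)))
  have hS₀ : ∀ v ∈ 𝒜, IsBddMeas P (genSig (Z 0)) (S₀ v) := fun v hv =>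
    (hRZ v hv 0 (by lia)).sub (.const _)
  have hd : ∀ v ∈ 𝒜, ∀ j ≤ p, IsBddMeas P (genSig (Z j)) (d v j) := fun v hv j hj =>
    (hRB v hv j hj).sub (hRZ v hv j hj)
  have hT : ∀ v ∈ 𝒜, ∀ j ∈ Finset.range (p + 1), IsBddMeas P mΩ (T v j) := fun v hv j hj =>
    have hj := Finset.mem_range.1 hj
    ((hd v hv j (by lia)).mono (hZle j (by lia))).mul
      ((hW v hv _ (by lia)).sub (hW v hv _ (by lia)))
  have hX : ∀ v ∈ 𝒜, IsBddMeas P mΩ (X v) := fun v hv =>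
    (IsBddMeas.sum (hS v hv)).add ((hS₀ v hv).mono (hZle 0 (by lia)))
  have hTsum : ∀ v ∈ 𝒜, IsBddMeas P mΩ fun ω => ∑ j ∈ Finset.range (p + 1), T v j ω :=
    fun v hv => .sum (hT v hv)
  have hmulT : ∀ w ∈ 𝒜, ∀ j ∈ Finset.range (p + 1), ∀ f, IsBddMeas P (genSig (Z j)) f →
      ∫ ω, f ω * T w j ω ∂P = 0 := by
    intro w hw j hj f hf
    have hj : j ≤ p := Nat.lt_succ_iff.1 (Finset.mem_range.1 hj)
    rw [← hist.integral_mul_ipWeight_sub hA (hBpos w hw) hj (hf.mul (hd w hw j hj))]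
    simp_rw [T, mul_assoc]
  have hXT : ∀ v ∈ 𝒜, ∀ w ∈ 𝒜, ∀ j ∈ Finset.range (p + 1), ∫ ω, X v ω * T w j ω ∂P = 0 := by
    intro v hv w hw j hj
    have hj' : j ≤ p := Nat.lt_succ_iff.1 (Finset.mem_range.1 hj)
    have hS₀j := (hS₀ v hv).mono (hist.mono 0 j (by lia) hj')
    simp_rw [X, add_mul]
    rw [integral_add ((IsBddMeas.sum (hS v hv)).mul (hT w hw j hj)).integrable
      ((hS₀j.mono (hZle j hj')).mul (hT w hw j hj)).integrable, hmulT w hw j hj _ hS₀j, add_zero]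
    refine integral_sum_mul_eq_zero (hS v hv) (hT w hw j hj) fun k hk => ?_
    have hk : k ≤ p := Nat.lt_succ_iff.1 (Finset.mem_range.1 hk)
    exact hist.integral_ipWeight_succ_mul_sub_mul hA (hBpos v hv) (hBpos w hw) hk hj'
      (hRZ v hv) (hRtop v hv _ (by lia)) (hreg v hv k hk) (hd w hw j hj')
  have hV : ∀ v ∈ 𝒜, psi P A v Y Z p =ᵐ[P] X v := by
    intro v hv
    have hw : ∀ᵐ ω ∂P, ∀ k ∈ Finset.range (p + 1),
        ipWeight P A v Z (k + 1) ω = ipWeight P A v B (k + 1) ω :=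
      (Finset.range (p + 1)).eventually_all.2 fun k hk =>
        ipWeight_ae_eq fun j hj => hist.condExp_ind j (by have := Finset.mem_range.1 hk; lia) (v j)
    filter_upwards [hw] with ω hω
    rw [psi_eq]
    exact congrArg (· + S₀ v ω) (Finset.sum_congr rfl fun k hk => by rw [hω k hk])
  have hU : ∀ v ω, psi P A v Y B p ω = X v ω + ∑ j ∈ Finset.range (p + 1), T v j ω +
      (∫ ω, bregExt P A v Y Z p 0 ω ∂P - ∫ ω, bregExt P A v Y B p 0 ω ∂P) := by
    intro v ω
    have hab := sum_range_mul_sub_add (fun k => ipWeight P A v B k ω) (fun k => d v k ω) (p + 1)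
    have hlast : d v (p + 1) ω = 0 := by simp [d, bregExt]
    simp only [hlast, ipWeight_zero, mul_zero, add_zero, one_mul] at hab
    have hsplit : ∑ k ∈ Finset.range (p + 1), ipWeight P A v B (k + 1) ω *
          (bregExt P A v Y B p (k + 1) ω - bregExt P A v Y B p k ω) =
        ∑ k ∈ Finset.range (p + 1), S v k ω + ∑ k ∈ Finset.range (p + 1),
          ipWeight P A v B (k + 1) ω * (d v (k + 1) ω - d v k ω) := by
      rw [← Finset.sum_add_distrib]
      exact Finset.sum_congr rfl fun k _ => by simp only [S, d]; ring
    rw [psi_eq, hsplit]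
    simp only [X, S₀, T, ← hab]
    simp only [d]
    ring
  refine sub_nonneg.2 (variance_le_variance_of_orthogonal
    (∑ v ∈ 𝒜, c v * (∫ ω, bregExt P A v Y Z p 0 ω ∂P - ∫ ω, bregExt P A v Y B p 0 ω ∂P))
    (X := fun ω => ∑ v ∈ 𝒜, c v * X v ω)
    (D := fun ω => ∑ v ∈ 𝒜, c v * ∑ j ∈ Finset.range (p + 1), T v j ω)
    (.sum fun v hv => (IsBddMeas.const _).mul (hX v hv))
    (.sum fun v hv => (IsBddMeas.const _).mul (hTsum v hv)) ?_ ?_ ?_ ?_)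
  · rw [integral_finsetSum _ fun v hv => ((IsBddMeas.const _).mul (hTsum v hv)).integrable]
    refine Finset.sum_eq_zero fun v hv => ?_
    rw [integral_const_mul, integral_finsetSum _ fun j hj => (hT v hv j hj).integrable,
      Finset.sum_eq_zero, mul_zero]
    intro j hj
    simpa using hmulT v hv j hj _ (.const 1)
  · refine integral_sum_mul_eq_zero (fun v hv => (IsBddMeas.const _).mul (hX v hv))
      (.sum fun v hv => (IsBddMeas.const _).mul (hTsum v hv)) fun v hv => ?_
    refine integral_mul_sum_eq_zero ((IsBddMeas.const _).mul (hX v hv))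
      (fun w hw => (IsBddMeas.const _).mul (hTsum w hw)) fun w hw => ?_
    simp_rw [mul_mul_mul_comm (c v)]
    rw [integral_const_mul, integral_mul_sum_eq_zero (hX v hv) (hT w hw) (hXT v hv w hw), mul_zero]
  · filter_upwards [𝒜.eventually_all.2 hV] with ω hω
    exact Finset.sum_congr rfl fun v hv => by rw [hω v hv]
  · refine ae_of_all _ fun ω => ?_
    simp only [hU, mul_add, Finset.sum_add_distrib]
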